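/- arXiv:2412.10268 — 15 statements merged into one kernel-verified Lean document; each statement's English description precedes it below -/
import Mathlib

section
/- Let (G,·,N,⋆,⊙) be a skew bracoid that is almost classical with respect to a subgroup H, and let S = Stab_G(e_N). Then for all s₁ ∈ S and all h₁, h₂ ∈ H, the γ-function satisfies γ(h₁s₁)(h₂ ⊙ e_N) = (s₁h₂s₁⁻¹) ⊙ e_N. -/
/-- Let `(G,·,N,⋆,⊙)` be a skew bracoid that is almost classical with respect to a
subgroup `H`, and let `S = Stab_G(e_N)`.  Then for all `s₁ ∈ S` and all
`h₁, h₂ ∈ H`, the `γ`-function satisfies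
`γ(h₁s₁)(h₂ ⊙ e_N) = (s₁h₂s₁⁻¹) ⊙ e_N`. -/
theorem gamma_of_almost_classical {G N : Type*} [Group G] [Group N]
    (dot : G → N → N)
    (h_one : ∀ η : N, dot 1 η = η)
    (h_mul : ∀ g g' : G, ∀ η : N, dot (g * g') η = dot g (dot g' η))
    (h_trans : ∀ η μ : N, ∃ g : G, dot g μ = η)
    (h_rel : ∀ g : G, ∀ η₁ η₂ : N,
      dot g (η₁ * η₂) = dot g η₁ * (dot g 1)⁻¹ * dot g η₂)
    (S H : Subgroup G)
    (hS : ∀ g : G, g ∈ S ↔ dot g 1 = 1)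
    (hHnorm : H.Normal)
    (h_fact : ∀ g : G, ∃ h ∈ H, ∃ s ∈ S, g = h * s)
    (h_int : ∀ g : G, g ∈ H → g ∈ S → g = 1)
    (h_ac : ∀ h₁ ∈ H, ∀ h₂ ∈ H, dot h₁ 1 * dot h₂ 1 = dot (h₁ * h₂) 1) :
    ∀ s₁ ∈ S, ∀ h₁ ∈ H, ∀ h₂ ∈ H,
      (dot (h₁ * s₁) 1)⁻¹ * dot (h₁ * s₁) (dot h₂ 1)
        = dot (s₁ * h₂ * s₁⁻¹) 1 := by
  intro s₁ hs₁ h₁ hh₁ h₂ hh₂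
  have hs : dot s₁ 1 = 1 := (hS s₁).mp hs₁
  have hconj : s₁ * h₂ * s₁⁻¹ ∈ H := hHnorm.conj_mem h₂ hh₂ s₁
  have hbase : dot (h₁ * s₁) 1 = dot h₁ 1 := by rw [h_mul, hs]
  have himage : dot (h₁ * s₁) (dot h₂ 1) = dot h₁ 1 * dot (s₁ * h₂ * s₁⁻¹) 1 := by
    have hsplit : h₁ * s₁ * h₂ = h₁ * (s₁ * h₂ * s₁⁻¹) * s₁ := by group
    rw [h_ac h₁ hh₁ _ hconj, ← h_mul, hsplit, h_mul _ s₁, hs]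
  rw [hbase, himage, inv_mul_cancel_left]
end

section
/- Let (G,·,N,⋆,⊙) be a skew bracoid that is almost a brace with respect to a subgroup H. Then γ(h)(η) = η for all h ∈ H and all η ∈ N if and only if (G,N,⊙) is almost classical with respect to H, i.e. if and only if (h₁ ⊙ e_N)(h₂ ⊙ e_N) = (h₁h₂) ⊙ e_N for all h₁, h₂ ∈ H. -/
/-- Let `(G,·,N,⋆,⊙)` be a skew bracoid that is almost a brace with respect to a
subgroup `H`.  Then `γ(h)(η) = η` for all `h ∈ H` and all `η ∈ N` if and only
if `(G,N,⊙)` is almost classical with respect to `H`, i.e. if and only if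
`(h₁ ⊙ e_N)(h₂ ⊙ e_N) = (h₁h₂) ⊙ e_N` for all `h₁, h₂ ∈ H`. -/
theorem gamma_trivial_iff_almost_classical {G N : Type*} [Group G] [Group N]
    (dot : G → N → N)
    (h_one : ∀ η : N, dot 1 η = η)
    (h_mul : ∀ g g' : G, ∀ η : N, dot (g * g') η = dot g (dot g' η))
    (h_trans : ∀ η μ : N, ∃ g : G, dot g μ = η)
    (h_rel : ∀ g : G, ∀ η₁ η₂ : N,
      dot g (η₁ * η₂) = dot g η₁ * (dot g 1)⁻¹ * dot g η₂)
    (S H : Subgroup G)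
    (hS : ∀ g : G, g ∈ S ↔ dot g 1 = 1)
    (hHnorm : H.Normal)
    (h_fact : ∀ g : G, ∃ h ∈ H, ∃ s ∈ S, g = h * s)
    (h_int : ∀ g : G, g ∈ H → g ∈ S → g = 1) :
    (∀ h ∈ H, ∀ η : N, (dot h 1)⁻¹ * dot h η = η) ↔
      (∀ h₁ ∈ H, ∀ h₂ ∈ H, dot h₁ 1 * dot h₂ 1 = dot (h₁ * h₂) 1) := by
  constructor
  · intro hγ h₁ hh₁ h₂ _
    rw [h_mul, ← inv_mul_eq_iff_eq_mul.mp (hγ h₁ hh₁ (dot h₂ 1))]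
  · intro hac h₁ hh₁ η
    obtain ⟨g, rfl⟩ := h_trans η 1
    obtain ⟨h₂, hh₂, s, hs, rfl⟩ := h_fact g
    rw [h_mul h₂ s, (hS s).mp hs, ← h_mul, ← hac h₁ hh₁ h₂ hh₂, inv_mul_cancel_left]
end

section
/- Let (G,·,N,⋆,⊙) be a skew bracoid that is almost classical with respect to a subgroup H, and let S = Stab_G(e_N). If G' is a subgroup of G containing S, then the orbit G' ⊙ e_N = {g' ⊙ e_N : g' ∈ G'} is stable under the γ-function of G: for every g ∈ G and every g' ∈ G', γ(g)(g' ⊙ e_N) ∈ G' ⊙ e_N. -/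
/-- Let `(G,·,N,⋆,⊙)` be a skew bracoid that is almost classical with respect to a
subgroup `H`, and let `S = Stab_G(e_N)`.  If `G'` is a subgroup of `G`
containing `S`, then the orbit `G' ⊙ e_N` is stable under the `γ`-function of
`G`: for every `g ∈ G` and every `g' ∈ G'`, `γ(g)(g' ⊙ e_N) ∈ G' ⊙ e_N`. -/
theorem orbit_gamma_stable_of_almost_classical {G N : Type*} [Group G] [Group N]
    (dot : G → N → N)
    (h_one : ∀ η : N, dot 1 η = η)
    (h_mul : ∀ g g' : G, ∀ η : N, dot (g * g') η = dot g (dot g' η))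
    (h_trans : ∀ η μ : N, ∃ g : G, dot g μ = η)
    (h_rel : ∀ g : G, ∀ η₁ η₂ : N,
      dot g (η₁ * η₂) = dot g η₁ * (dot g 1)⁻¹ * dot g η₂)
    (S H : Subgroup G)
    (hS : ∀ g : G, g ∈ S ↔ dot g 1 = 1)
    (hHnorm : H.Normal)
    (h_fact : ∀ g : G, ∃ h ∈ H, ∃ s ∈ S, g = h * s)
    (h_int : ∀ g : G, g ∈ H → g ∈ S → g = 1)
    (h_ac : ∀ h₁ ∈ H, ∀ h₂ ∈ H, dot h₁ 1 * dot h₂ 1 = dot (h₁ * h₂) 1)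
    (G' : Subgroup G) (hSG' : S ≤ G') :
    ∀ g : G, ∀ g' ∈ G', ∃ g'' ∈ G',
      (dot g 1)⁻¹ * dot g (dot g' 1) = dot g'' 1 := by
  intro g g' hg'
  obtain ⟨h, hh, s, hs, rfl⟩ := h_fact g
  obtain ⟨k, hk, t, ht, rfl⟩ := h_fact g'
  have hkG' : k ∈ G' := (G'.mul_mem_cancel_right (hSG' ht)).mp hg'
  have hconj : s * k * s⁻¹ ∈ H := hHnorm.conj_mem k hk s
  have hs_inv : dot s⁻¹ 1 = 1 := (hS _).mp (S.inv_mem hs)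
  refine ⟨s * k * s⁻¹,
    G'.mul_mem (G'.mul_mem (hSG' hs) hkG') (G'.inv_mem (hSG' hs)), ?_⟩
  rw [inv_mul_eq_iff_eq_mul, h_mul h s 1, (hS s).mp hs, h_ac h hh _ hconj]
  simp only [h_mul, (hS t).mp ht, hs_inv]
end

section
/- Let (G,·,N,⋆,⊙_N) be a skew bracoid that is almost a brace with respect to a subgroup H, let S = Stab_G(e_N), and let π : G → S be the group homomorphism with π(s) = s for all s ∈ S and π(h) = e_G for all h ∈ H (the projection associated to G = H ⋊ S). Let (S,M,⊙_M) be a skew bracoid. Then the formula g ⊙ (η,μ) := (g ⊙_N η, π(g) ⊙_M μ) defines a transitive action of G on the direct product group N × M which satisfies the skew bracoid relation; that is, (G, N × M, ⊙) is a skew bracoid. -/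
/-- Let `(G,·,N,⋆,⊙_N)` be a skew bracoid that is almost a brace with respect to
`H`, let `S = Stab_G(e_N)`, and let `π : G → S` be the projection homomorphism
associated to `G = H ⋊ S`.  Let `(S,M,⊙_M)` be a skew bracoid.  Then the
formula `g ⊙ (η,μ) := (g ⊙_N η, π(g) ⊙_M μ)` defines a transitive action of
`G` on `N × M` satisfying the skew bracoid relation; that is, `(G, N × M, ⊙)`
is a skew bracoid. -/
theorem induced_skew_bracoid {G N M : Type*} [Group G] [Group N] [Group M]
    (dotN : G → N → N)
    (hN_one : ∀ η : N, dotN 1 η = η)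
    (hN_mul : ∀ g g' : G, ∀ η : N, dotN (g * g') η = dotN g (dotN g' η))
    (hN_trans : ∀ η μ : N, ∃ g : G, dotN g μ = η)
    (hN_rel : ∀ g : G, ∀ η₁ η₂ : N,
      dotN g (η₁ * η₂) = dotN g η₁ * (dotN g 1)⁻¹ * dotN g η₂)
    (S H : Subgroup G)
    (hS : ∀ g : G, g ∈ S ↔ dotN g 1 = 1)
    (hHnorm : H.Normal)
    (h_fact : ∀ g : G, ∃ h ∈ H, ∃ s ∈ S, g = h * s)
    (h_int : ∀ g : G, g ∈ H → g ∈ S → g = 1)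
    (π : G →* S)
    (hπS : ∀ s : S, π (s : G) = s)
    (hπH : ∀ h ∈ H, π h = 1)
    (dotM : S → M → M)
    (hM_one : ∀ μ : M, dotM 1 μ = μ)
    (hM_mul : ∀ s s' : S, ∀ μ : M, dotM (s * s') μ = dotM s (dotM s' μ))
    (hM_trans : ∀ μ ν : M, ∃ s : S, dotM s ν = μ)
    (hM_rel : ∀ s : S, ∀ μ₁ μ₂ : M,
      dotM s (μ₁ * μ₂) = dotM s μ₁ * (dotM s 1)⁻¹ * dotM s μ₂) :
    ∃ Dot : G → N × M → N × M,
      (∀ g : G, ∀ p : N × M, Dot g p = (dotN g p.1, dotM (π g) p.2)) ∧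
      (∀ p : N × M, Dot 1 p = p) ∧
      (∀ g g' : G, ∀ p : N × M, Dot (g * g') p = Dot g (Dot g' p)) ∧
      (∀ p q : N × M, ∃ g : G, Dot g q = p) ∧
      (∀ g : G, ∀ p₁ p₂ : N × M,
        Dot g (p₁ * p₂) = Dot g p₁ * (Dot g 1)⁻¹ * Dot g p₂) := by
  have hH_trans : ∀ η : N, ∃ h ∈ H, dotN h 1 = η := by
    intro η
    obtain ⟨g, hg⟩ := hN_trans η 1
    obtain ⟨h, hh, s, hs, rfl⟩ := h_fact g
    refine ⟨h, hh, ?_⟩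
    rwa [hN_mul, (hS s).1 hs] at hg
  refine ⟨fun g p => (dotN g p.1, dotM (π g) p.2), fun _ _ => rfl, fun p => ?_,
    fun g g' p => ?_, fun p q => ?_, fun g p₁ p₂ => ?_⟩
  · simp only [map_one, hN_one, hM_one]
  · simp only [map_mul, hN_mul, hM_mul]
  · obtain ⟨h, hh, hp⟩ := hH_trans p.1
    obtain ⟨k, hk, hq⟩ := hH_trans q.1
    obtain ⟨s, hs⟩ := hM_trans p.2 q.2
    refine ⟨h * s * k⁻¹, Prod.ext ?_ ?_⟩
    · change dotN (h * s * k⁻¹) q.1 = p.1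
      rw [hN_mul, ← hq, ← hN_mul k⁻¹ k, inv_mul_cancel, hN_one, hN_mul,
        (hS s).1 s.2, hp]
    · change dotM (π (h * s * k⁻¹)) q.2 = p.2
      rw [map_mul, map_mul, map_inv, hπH h hh, hπH k hk, hπS, one_mul, inv_one,
        mul_one, hs]
  · exact Prod.ext (hN_rel g p₁.1 p₂.1) (hM_rel (π g) p₁.2 p₂.2)
end

section
/- Let (G,·,N,⋆,⊙_N) be a skew bracoid that is almost a brace with respect to a subgroup H, let S = Stab_G(e_N), π : G → S the projection homomorphism, and let (S,M,⊙_M) be a skew bracoid that contains a brace with respect to a subgroup R of S. Let S_M = Stab_S(e_M). Then the set HR = {hr : h ∈ H, r ∈ R} is a subgroup of G, G = (HR)S_M is an exact factorisation (every g ∈ G equals (hr)t with hr ∈ HR, t ∈ S_M, and HR ∩ S_M = {e_G}); that is, the induced skew bracoid (G, N × M) contains a brace with respect to HR. -/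
/-- Let `(G,N,⊙_N)` be a skew bracoid that is almost a brace with respect to `H`,
`S = Stab_G(e_N)`, and let `(S,M,⊙_M)` be a skew bracoid that contains a brace
with respect to a subgroup `R` of `S`.  Let `S_M = Stab_S(e_M)`.  Then
`HR = {hr : h ∈ H, r ∈ R}` is a subgroup of `G`, `G = (HR)S_M` is an exact
factorisation; that is, the induced skew bracoid `(G, N × M)` contains a brace
with respect to `HR`. -/
theorem induced_contains_brace {G N M : Type*} [Group G] [Group N] [Group M]
    (dotN : G → N → N)
    (hN_one : ∀ η : N, dotN 1 η = η)
    (hN_mul : ∀ g g' : G, ∀ η : N, dotN (g * g') η = dotN g (dotN g' η))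
    (hN_trans : ∀ η μ : N, ∃ g : G, dotN g μ = η)
    (hN_rel : ∀ g : G, ∀ η₁ η₂ : N,
      dotN g (η₁ * η₂) = dotN g η₁ * (dotN g 1)⁻¹ * dotN g η₂)
    (S H : Subgroup G)
    (hS : ∀ g : G, g ∈ S ↔ dotN g 1 = 1)
    (hHnorm : H.Normal)
    (h_fact : ∀ g : G, ∃ h ∈ H, ∃ s ∈ S, g = h * s)
    (h_int : ∀ g : G, g ∈ H → g ∈ S → g = 1)
    (dotM : S → M → M)
    (hM_one : ∀ μ : M, dotM 1 μ = μ)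
    (hM_mul : ∀ s s' : S, ∀ μ : M, dotM (s * s') μ = dotM s (dotM s' μ))
    (hM_trans : ∀ μ ν : M, ∃ s : S, dotM s ν = μ)
    (hM_rel : ∀ s : S, ∀ μ₁ μ₂ : M,
      dotM s (μ₁ * μ₂) = dotM s μ₁ * (dotM s 1)⁻¹ * dotM s μ₂)
    (R : Subgroup S)
    (hR_fact : ∀ s : S, ∃ r ∈ R, ∃ t : S, dotM t 1 = 1 ∧ s = r * t)
    (hR_int : ∀ s : S, s ∈ R → dotM s 1 = 1 → s = 1) :
    ∃ HR : Subgroup G,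
      (∀ g : G, g ∈ HR ↔ ∃ h ∈ H, ∃ r ∈ R, g = h * (r : G)) ∧
      (∀ g : G, ∃ k ∈ HR, ∃ t : S, dotM t 1 = 1 ∧ g = k * (t : G)) ∧
      (∀ g ∈ HR, ∀ hg : g ∈ S, dotM ⟨g, hg⟩ (1 : M) = 1 → g = 1) := by
  have mem_HR : ∀ g : G, g ∈ H ⊔ R.map S.subtype ↔ ∃ h ∈ H, ∃ r ∈ R, g = h * (r : G) := by
    intro g
    rw [← SetLike.mem_coe, Subgroup.normal_mul, Set.mem_mul]
    constructor
    · rintro ⟨h, hh, _, ⟨r, hr, rfl⟩, rfl⟩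
      exact ⟨h, hh, r, hr, rfl⟩
    · rintro ⟨h, hh, r, hr, rfl⟩
      exact ⟨h, hh, r, ⟨r, hr, rfl⟩, rfl⟩
  refine ⟨H ⊔ R.map S.subtype, mem_HR, fun g => ?_, fun g hg hgS hg1 => ?_⟩
  · obtain ⟨h, hh, s, hs, rfl⟩ := h_fact g
    obtain ⟨r, hr, t, ht, hst⟩ := hR_fact ⟨s, hs⟩
    refine ⟨h * r, (mem_HR _).2 ⟨h, hh, r, hr, rfl⟩, t, ht, ?_⟩
    rw [mul_assoc, ← Subgroup.coe_mul, ← hst]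
  · obtain ⟨h, hh, r, hr, rfl⟩ := (mem_HR g).1 hg
    obtain rfl : h = 1 := h_int h hh ((S.mul_mem_cancel_right r.2).1 hgS)
    simp only [one_mul] at hg1 ⊢
    rw [hR_int r hr hg1, Subgroup.coe_one]
end

section
/- Let (G,·,N,⋆,⊙_N) be a skew bracoid that is almost a brace with respect to a subgroup H, let S = Stab_G(e_N), and let (S,M,⊙_M) be a skew bracoid that is almost a brace with respect to a subgroup R of S (so R is normal in S). Then the subgroup HR = {hr : h ∈ H, r ∈ R} is normal in G; consequently the induced skew bracoid (G, N × M) is almost a brace with respect to HR. -/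
/-- If `H` is normal in `G`, `G = HS`, and `R` is normal in `S`, then `HR` is normal in `G`. -/
theorem Subgroup.normal_sup_map_subtype {G : Type*} [Group G] {S H : Subgroup G} [hH : H.Normal]
    (h_fact : ∀ g : G, ∃ h ∈ H, ∃ s ∈ S, g = h * s) {R : Subgroup S} (hR : R.Normal) :
    (H ⊔ R.map S.subtype).Normal := by
  have hle : H ≤ H ⊔ R.map S.subtype := le_sup_left
  refine ⟨fun x hx g => ?_⟩
  obtain ⟨h₀, hh₀, s, hs, rfl⟩ := h_fact g
  obtain ⟨h, hh, _, ⟨r, hr, rfl⟩, rfl⟩ := Subgroup.mem_sup_of_normal_left.mp hx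
  have hr' : s * (r : G) * s⁻¹ ∈ H ⊔ R.map S.subtype :=
    le_sup_right (a := H) ⟨⟨s, hs⟩ * r * ⟨s, hs⟩⁻¹, hR.conj_mem r hr ⟨s, hs⟩, rfl⟩
  have key := mul_mem (mul_mem (mul_mem (hle hh₀) (hle (hH.conj_mem h hh s))) hr')
    (inv_mem (hle hh₀))
  convert key using 1
  simp only [Subgroup.coe_subtype]
  group

/-- Let `(G,N,⊙_N)` be a skew bracoid that is almost a brace with respect to `H`,
`S = Stab_G(e_N)`, and let `(S,M,⊙_M)` be a skew bracoid that is almost a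
brace with respect to a subgroup `R` of `S` (so `R` is normal in `S`).  Then
the subgroup `HR = {hr : h ∈ H, r ∈ R}` is normal in `G`; consequently the
induced skew bracoid `(G, N × M)` is almost a brace with respect to `HR`. -/
theorem induced_almost_a_brace {G N M : Type*} [Group G] [Group N] [Group M]
    (dotN : G → N → N)
    (hN_one : ∀ η : N, dotN 1 η = η)
    (hN_mul : ∀ g g' : G, ∀ η : N, dotN (g * g') η = dotN g (dotN g' η))
    (hN_trans : ∀ η μ : N, ∃ g : G, dotN g μ = η)
    (hN_rel : ∀ g : G, ∀ η₁ η₂ : N,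
      dotN g (η₁ * η₂) = dotN g η₁ * (dotN g 1)⁻¹ * dotN g η₂)
    (S H : Subgroup G)
    (hS : ∀ g : G, g ∈ S ↔ dotN g 1 = 1)
    (hHnorm : H.Normal)
    (h_fact : ∀ g : G, ∃ h ∈ H, ∃ s ∈ S, g = h * s)
    (h_int : ∀ g : G, g ∈ H → g ∈ S → g = 1)
    (dotM : S → M → M)
    (hM_one : ∀ μ : M, dotM 1 μ = μ)
    (hM_mul : ∀ s s' : S, ∀ μ : M, dotM (s * s') μ = dotM s (dotM s' μ))
    (hM_trans : ∀ μ ν : M, ∃ s : S, dotM s ν = μ)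
    (hM_rel : ∀ s : S, ∀ μ₁ μ₂ : M,
      dotM s (μ₁ * μ₂) = dotM s μ₁ * (dotM s 1)⁻¹ * dotM s μ₂)
    (R : Subgroup S)
    (hRnorm : R.Normal)
    (hR_fact : ∀ s : S, ∃ r ∈ R, ∃ t : S, dotM t 1 = 1 ∧ s = r * t)
    (hR_int : ∀ s : S, s ∈ R → dotM s 1 = 1 → s = 1) :
    ∃ HR : Subgroup G,
      (∀ g : G, g ∈ HR ↔ ∃ h ∈ H, ∃ r ∈ R, g = h * (r : G)) ∧
      HR.Normal ∧
      (∀ g : G, ∃ k ∈ HR, ∃ t : S, dotM t 1 = 1 ∧ g = k * (t : G)) ∧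
      (∀ g ∈ HR, ∀ hg : g ∈ S, dotM ⟨g, hg⟩ (1 : M) = 1 → g = 1) := by
  have hmem : ∀ g : G, g ∈ H ⊔ R.map S.subtype ↔ ∃ h ∈ H, ∃ r ∈ R, g = h * (r : G) := by
    intro g
    rw [Subgroup.mem_sup_of_normal_left]
    constructor
    · rintro ⟨h, hh, _, ⟨r, hr, rfl⟩, rfl⟩
      exact ⟨h, hh, r, hr, rfl⟩
    · rintro ⟨h, hh, r, hr, rfl⟩
      exact ⟨h, hh, r, ⟨r, hr, rfl⟩, rfl⟩
  refine ⟨H ⊔ R.map S.subtype, hmem, Subgroup.normal_sup_map_subtype h_fact hRnorm, ?_, ?_⟩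
  · intro g
    obtain ⟨h, hh, s, hs, rfl⟩ := h_fact g
    obtain ⟨r, hr, t, ht, hst⟩ := hR_fact ⟨s, hs⟩
    refine ⟨h * r, (hmem _).mpr ⟨h, hh, r, hr, rfl⟩, t, ht, ?_⟩
    rw [mul_assoc, ← Subgroup.coe_mul, ← hst]
  · intro g hg hgS hfix
    obtain ⟨h, hh, r, hr, rfl⟩ := (hmem g).mp hg
    obtain rfl : h = 1 := h_int h hh ((Subgroup.mul_mem_cancel_right S r.2).mp hgS)
    have hr1 : r = 1 := hR_int r hr (by simpa using hfix)
    simp [hr1]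
end

section
/- Let (G,·,N,⋆,⊙) be a skew bracoid, let K = {g ∈ G : g ⊙ η = η for all η ∈ N} be the kernel of the action (a normal subgroup of G contained in S = Stab_G(e_N)), let q : G → G/K be the quotient map, and let ⊙' be the action of G/K on N determined by q(g) ⊙' η = g ⊙ η. If (G,N,⊙) is almost a brace with respect to H, then (G/K, N, ⊙') is a skew bracoid whose stabiliser of e_N is q(S), and it is almost a brace with respect to q(H): q(H) is normal in G/K, G/K = q(H)q(S), and q(H) ∩ q(S) is trivial. -/
/-- Let `(G,N,⊙)` be a skew bracoid, `K` the kernel of the action, `q : G → G/K`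
the quotient map, and `⊙'` the action of `G/K` on `N` with `q(g) ⊙' η = g ⊙ η`.
If `(G,N,⊙)` is almost a brace with respect to `H`, then `(G/K, N, ⊙')` is a
skew bracoid whose stabiliser of `e_N` is `q(S)`, and it is almost a brace
with respect to `q(H)`. -/
theorem reduced_form_almost_a_brace {G N : Type*} [Group G] [Group N]
    (dot : G → N → N)
    (h_one : ∀ η : N, dot 1 η = η)
    (h_mul : ∀ g g' : G, ∀ η : N, dot (g * g') η = dot g (dot g' η))
    (h_trans : ∀ η μ : N, ∃ g : G, dot g μ = η)
    (h_rel : ∀ g : G, ∀ η₁ η₂ : N,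
      dot g (η₁ * η₂) = dot g η₁ * (dot g 1)⁻¹ * dot g η₂)
    (S H : Subgroup G)
    (hS : ∀ g : G, g ∈ S ↔ dot g 1 = 1)
    (hHnorm : H.Normal)
    (h_fact : ∀ g : G, ∃ h ∈ H, ∃ s ∈ S, g = h * s)
    (h_int : ∀ g : G, g ∈ H → g ∈ S → g = 1)
    (K : Subgroup G) [hKnorm : K.Normal]
    (hK : ∀ g : G, g ∈ K ↔ ∀ η : N, dot g η = η)
    (dot' : G ⧸ K → N → N)
    (hdot' : ∀ g : G, ∀ η : N, dot' ((g : G ⧸ K)) η = dot g η) :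
    (∀ η : N, dot' 1 η = η) ∧
    (∀ x y : G ⧸ K, ∀ η : N, dot' (x * y) η = dot' x (dot' y η)) ∧
    (∀ η μ : N, ∃ x : G ⧸ K, dot' x μ = η) ∧
    (∀ x : G ⧸ K, ∀ η₁ η₂ : N,
      dot' x (η₁ * η₂) = dot' x η₁ * (dot' x 1)⁻¹ * dot' x η₂) ∧
    (∀ x : G ⧸ K, dot' x 1 = 1 ↔ x ∈ S.map (QuotientGroup.mk' K)) ∧
    (H.map (QuotientGroup.mk' K)).Normal ∧
    (∀ x : G ⧸ K, ∃ h ∈ H.map (QuotientGroup.mk' K),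
      ∃ s ∈ S.map (QuotientGroup.mk' K), x = h * s) ∧
    (∀ x : G ⧸ K, x ∈ H.map (QuotientGroup.mk' K) →
      x ∈ S.map (QuotientGroup.mk' K) → x = 1) := by
  have stab (x : G ⧸ K) : dot' x 1 = 1 ↔ x ∈ S.map (QuotientGroup.mk' K) := by
    constructor
    · induction x using QuotientGroup.induction_on with
      | H g =>
        intro hx
        exact ⟨g, (hS g).2 ((hdot' g 1).symm.trans hx), rfl⟩
    · rintro ⟨s, hs, rfl⟩
      exact (hdot' s 1).trans ((hS s).1 hs)
  refine ⟨fun η => (hdot' 1 η).trans (h_one η), fun x y η => ?_, fun η μ => ?_,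
    fun x η₁ η₂ => ?_, stab, hHnorm.map _ (QuotientGroup.mk'_surjective K), fun x => ?_, ?_⟩
  · induction x using QuotientGroup.induction_on with
    | H g =>
      induction y using QuotientGroup.induction_on with
      | H g' => rw [← QuotientGroup.mk_mul, hdot', hdot', hdot', h_mul]
  · obtain ⟨g, hg⟩ := h_trans η μ
    exact ⟨g, (hdot' g μ).trans hg⟩
  · induction x using QuotientGroup.induction_on with
    | H g => simp only [hdot', h_rel g η₁ η₂]
  · induction x using QuotientGroup.induction_on with
    | H g =>
      obtain ⟨h, hh, s, hs, rfl⟩ := h_fact g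
      exact ⟨h, ⟨h, hh, rfl⟩, s, ⟨s, hs, rfl⟩, rfl⟩
  · rintro _ ⟨h, hh, rfl⟩ hx
    have h_fix : dot h 1 = 1 := (hdot' h 1).symm.trans ((stab _).2 hx)
    rw [h_int h hh ((hS h).2 h_fix), map_one]
end

section
/- Let (G,·,N,⋆,⊙) be a skew bracoid, let K = {g ∈ G : g ⊙ η = η for all η ∈ N} be the kernel of the action, let q : G → G/K be the quotient map, and let ⊙' be the action of G/K on N determined by q(g) ⊙' η = g ⊙ η. If (G,N,⊙) is almost classical with respect to H, then the skew bracoid (G/K, N, ⊙') is almost classical with respect to q(H); in particular (q(h₁) ⊙' e_N)(q(h₂) ⊙' e_N) = q(h₁h₂) ⊙' e_N for all h₁, h₂ ∈ H. -/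
/-- Let `(G,N,⊙)` be a skew bracoid, `K` the kernel of the action, `q : G → G/K`
the quotient map, and `⊙'` the action of `G/K` on `N` with `q(g) ⊙' η = g ⊙ η`.
If `(G,N,⊙)` is almost classical with respect to `H`, then `(G/K, N, ⊙')` is
almost classical with respect to `q(H)`; in particular
`(q(h₁) ⊙' e_N)(q(h₂) ⊙' e_N) = q(h₁h₂) ⊙' e_N` for all `h₁, h₂ ∈ H`. -/
theorem reduced_form_almost_classical {G N : Type*} [Group G] [Group N]
    (dot : G → N → N)
    (h_one : ∀ η : N, dot 1 η = η)
    (h_mul : ∀ g g' : G, ∀ η : N, dot (g * g') η = dot g (dot g' η))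
    (h_trans : ∀ η μ : N, ∃ g : G, dot g μ = η)
    (h_rel : ∀ g : G, ∀ η₁ η₂ : N,
      dot g (η₁ * η₂) = dot g η₁ * (dot g 1)⁻¹ * dot g η₂)
    (S H : Subgroup G)
    (hS : ∀ g : G, g ∈ S ↔ dot g 1 = 1)
    (hHnorm : H.Normal)
    (h_fact : ∀ g : G, ∃ h ∈ H, ∃ s ∈ S, g = h * s)
    (h_int : ∀ g : G, g ∈ H → g ∈ S → g = 1)
    (h_ac : ∀ h₁ ∈ H, ∀ h₂ ∈ H, dot h₁ 1 * dot h₂ 1 = dot (h₁ * h₂) 1)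
    (K : Subgroup G) [hKnorm : K.Normal]
    (hK : ∀ g : G, g ∈ K ↔ ∀ η : N, dot g η = η)
    (dot' : G ⧸ K → N → N)
    (hdot' : ∀ g : G, ∀ η : N, dot' ((g : G ⧸ K)) η = dot g η) :
    (H.map (QuotientGroup.mk' K)).Normal ∧
    (∀ x : G ⧸ K, ∃ h ∈ H.map (QuotientGroup.mk' K),
      ∃ s ∈ S.map (QuotientGroup.mk' K), x = h * s) ∧
    (∀ x : G ⧸ K, x ∈ H.map (QuotientGroup.mk' K) →
      x ∈ S.map (QuotientGroup.mk' K) → x = 1) ∧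
    (∀ x ∈ H.map (QuotientGroup.mk' K), ∀ y ∈ H.map (QuotientGroup.mk' K),
      dot' x 1 * dot' y 1 = dot' (x * y) 1) ∧
    (∀ h₁ ∈ H, ∀ h₂ ∈ H,
      dot' ((h₁ : G ⧸ K)) 1 * dot' ((h₂ : G ⧸ K)) 1
        = dot' ((h₁ * h₂ : G) : G ⧸ K) 1) := by
  refine ⟨hHnorm.map _ (QuotientGroup.mk'_surjective K), ?_, ?_, ?_, ?_⟩
  · intro x
    obtain ⟨g, rfl⟩ := QuotientGroup.mk'_surjective K x
    obtain ⟨h, hh, s, hs, rfl⟩ := h_fact g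
    exact ⟨_, Subgroup.mem_map_of_mem _ hh, _, Subgroup.mem_map_of_mem _ hs, map_mul _ h s⟩
  · rintro _ ⟨h, hh, rfl⟩ ⟨s, hs, hsh⟩
    have hfix : dot h 1 = 1 := by
      calc
        dot h 1 = dot' h 1 := (hdot' h 1).symm
        _ = dot' s 1 := congrArg (dot' · 1) hsh.symm
        _ = dot s 1 := hdot' s 1
        _ = 1 := (hS s).1 hs
    rw [h_int h hh ((hS h).2 hfix), map_one]
  · rintro _ ⟨h₁, hh₁, rfl⟩ _ ⟨h₂, hh₂, rfl⟩
    rw [← map_mul]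
    simp only [QuotientGroup.mk'_apply, hdot']
    exact h_ac h₁ hh₁ h₂ hh₂
  · intro h₁ hh₁ h₂ hh₂
    simp only [hdot']
    exact h_ac h₁ hh₁ h₂ hh₂
end

section
/- Let (G,·,N,⋆,⊙) be a skew bracoid that is almost classical with respect to a subgroup H. Then {(h ⊙ e_N, γ(h)) : h ∈ H} = {(η, id_N) : η ∈ N}; that is, γ(h) is the identity map on N for every h ∈ H, and the map H → N, h ↦ h ⊙ e_N, is a bijection. -/
/-- Let `(G,N,⊙)` be a skew bracoid that is almost classical with respect to `H`.
Then `{(h ⊙ e_N, γ(h)) : h ∈ H} = {(η, id_N) : η ∈ N}`; that is, `γ(h)` is the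
identity map on `N` for every `h ∈ H`, and the map `H → N`, `h ↦ h ⊙ e_N`, is
a bijection. -/
theorem almost_classical_lambda_image {G N : Type*} [Group G] [Group N]
    (dot : G → N → N)
    (h_one : ∀ η : N, dot 1 η = η)
    (h_mul : ∀ g g' : G, ∀ η : N, dot (g * g') η = dot g (dot g' η))
    (h_trans : ∀ η μ : N, ∃ g : G, dot g μ = η)
    (h_rel : ∀ g : G, ∀ η₁ η₂ : N,
      dot g (η₁ * η₂) = dot g η₁ * (dot g 1)⁻¹ * dot g η₂)
    (S H : Subgroup G)
    (hS : ∀ g : G, g ∈ S ↔ dot g 1 = 1)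
    (hHnorm : H.Normal)
    (h_fact : ∀ g : G, ∃ h ∈ H, ∃ s ∈ S, g = h * s)
    (h_int : ∀ g : G, g ∈ H → g ∈ S → g = 1)
    (h_ac : ∀ h₁ ∈ H, ∀ h₂ ∈ H, dot h₁ 1 * dot h₂ 1 = dot (h₁ * h₂) 1) :
    (∀ h ∈ H, ∀ η : N, (dot h 1)⁻¹ * dot h η = η) ∧
    Function.Bijective (fun h : H => dot (h : G) 1) := by
  have surj : ∀ η : N, ∃ h ∈ H, dot h 1 = η := by
    intro η
    obtain ⟨g, hg⟩ := h_trans η 1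
    obtain ⟨h, hh, s, hs, rfl⟩ := h_fact g
    exact ⟨h, hh, by rw [← hg, h_mul, (hS s).1 hs]⟩
  refine ⟨?_, ?_, ?_⟩
  · intro h hh η
    obtain ⟨k, hk, rfl⟩ := surj η
    rw [← h_mul, ← h_ac h hh k hk, inv_mul_cancel_left]
  · rintro ⟨h, hh⟩ ⟨k, hk⟩ hhk
    have hdot : dot h 1 = dot k 1 := hhk
    have hmem : h⁻¹ * k ∈ S := by
      rw [hS, h_mul, ← hdot, ← h_mul, inv_mul_cancel, h_one]
    have heq := h_int _ (H.mul_mem (H.inv_mem hh) hk) hmem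
    exact Subtype.ext (inv_mul_eq_one.1 heq)
  · intro η
    obtain ⟨h, hh, rfl⟩ := surj η
    exact ⟨⟨h, hh⟩, rfl⟩
end

section
/- Let (G,·,N,⋆,⊙) be a skew bracoid whose action ⊙ is faithful, and suppose that for every η ∈ N there exists g ∈ G with g ⊙ e_N = η and γ(g) = id_N. Let H = {g ∈ G : γ(g)(η) = η for all η ∈ N} and S = Stab_G(e_N). Then H is a normal subgroup of G, G = HS with H ∩ S = {e_G}, and (h₁ ⊙ e_N)(h₂ ⊙ e_N) = (h₁h₂) ⊙ e_N for all h₁, h₂ ∈ H; that is, (G,N,⊙) is almost classical with respect to H. -/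
/-- Let `(G,N,⊙)` be a skew bracoid whose action is faithful, and suppose that for
every `η ∈ N` there exists `g ∈ G` with `g ⊙ e_N = η` and `γ(g) = id_N`.  Let
`H = {g ∈ G : γ(g) = id}` and `S = Stab_G(e_N)`.  Then `H` is a normal
subgroup of `G`, `G = HS` with `H ∩ S = {e_G}`, and
`(h₁ ⊙ e_N)(h₂ ⊙ e_N) = (h₁h₂) ⊙ e_N` for all `h₁, h₂ ∈ H`; that is,
`(G,N,⊙)` is almost classical with respect to `H`. -/
theorem almost_classical_of_gamma_kernel_transitive {G N : Type*} [Group G] [Group N]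
    (dot : G → N → N)
    (h_one : ∀ η : N, dot 1 η = η)
    (h_mul : ∀ g g' : G, ∀ η : N, dot (g * g') η = dot g (dot g' η))
    (h_trans : ∀ η μ : N, ∃ g : G, dot g μ = η)
    (h_rel : ∀ g : G, ∀ η₁ η₂ : N,
      dot g (η₁ * η₂) = dot g η₁ * (dot g 1)⁻¹ * dot g η₂)
    (h_faith : ∀ g : G, (∀ η : N, dot g η = η) → g = 1)
    (h_reg : ∀ η : N, ∃ g : G, dot g 1 = η ∧ ∀ μ : N, (dot g 1)⁻¹ * dot g μ = μ) :
    ∃ H : Subgroup G,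
      (∀ g : G, g ∈ H ↔ ∀ η : N, (dot g 1)⁻¹ * dot g η = η) ∧
      H.Normal ∧
      (∀ g : G, ∃ h ∈ H, ∃ s : G, dot s 1 = 1 ∧ g = h * s) ∧
      (∀ g ∈ H, dot g 1 = 1 → g = 1) ∧
      (∀ h₁ ∈ H, ∀ h₂ ∈ H, dot h₁ 1 * dot h₂ 1 = dot (h₁ * h₂) 1) := by
  have inv_dot (g : G) (η : N) : dot g⁻¹ (dot g η) = η := by
    rw [← h_mul, inv_mul_cancel, h_one]
  have dot_inv (g : G) (η : N) : dot g (dot g⁻¹ η) = η := by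
    rw [← h_mul, mul_inv_cancel, h_one]
  simp only [inv_mul_eq_iff_eq_mul] at h_reg ⊢
  let H : Subgroup G :=
    { carrier := {g | ∀ η : N, dot g η = dot g 1 * η}
      one_mem' := fun η => by simp only [h_one, one_mul]
      mul_mem' := fun {a b} ha hb η => by
        rw [h_mul, h_mul, hb η, ha (dot b 1 * η), ha (dot b 1), mul_assoc]
      inv_mem' := fun {a} ha η => by
        have h (μ : N) : dot a⁻¹ μ = (dot a 1)⁻¹ * μ := by
          rw [eq_inv_mul_iff_mul_eq, ← ha, dot_inv]
        rw [h η, h 1, mul_one] }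
  refine ⟨H, fun g => Iff.rfl, ⟨fun h hh g η => ?_⟩, fun g => ?_, fun g hg hg1 => ?_,
    fun h₁ hh₁ h₂ _ => ?_⟩
  · have conj (μ : N) : dot (g * h * g⁻¹) μ = dot g (dot h 1) * (dot g 1)⁻¹ * μ := by
      rw [h_mul, h_mul, hh, h_rel, dot_inv]
    rw [conj η, conj 1, mul_one]
  · obtain ⟨h, hg1, hh⟩ := h_reg (dot g 1)
    exact ⟨h, hh, h⁻¹ * g, by rw [h_mul, ← hg1, inv_dot], (mul_inv_cancel_left h g).symm⟩
  · exact h_faith g fun η => by rw [hg η, hg1, one_mul]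
  · rw [h_mul, hh₁ (dot h₂ 1)]
end

section
/- Let G be a group, S a subgroup of G, X = G/S the left coset space, and N a group with identity e_N. Let β : G → Perm(N) be an injective group homomorphism such that β(G) acts transitively on N and, for g ∈ G, β(g)(e_N) = e_N if and only if g ∈ S. Then b : X → N defined by b(gS) = β(g)(e_N) is a well-defined bijection with b(S) = e_N, and α : N → Perm(X) defined by α(η) = b⁻¹ ∘ ρ_N(η) ∘ b, where ρ_N(η)(μ) = μη⁻¹ is the right regular representation, is an injective group homomorphism whose image acts regularly (simply transitively) on X. -/
/-- The bijection `G ⧸ S ≃ N`, `gS ↦ β g x`, attached to a transitive permutation representation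
`β` of `G` on `N` in which `S` is the stabiliser of `x`. -/
noncomputable def quotientEquivOfTransitive {G N : Type*} [Group G] (S : Subgroup G)
    (β : G →* Equiv.Perm N) (x : N) (htrans : ∀ y : N, ∃ g : G, β g x = y)
    (hstab : ∀ g : G, β g x = x ↔ g ∈ S) : G ⧸ S ≃ N :=
  have key (g h : G) : g⁻¹ * h ∈ S ↔ β g x = β h x := by
    rw [← hstab, map_mul, map_inv, Equiv.Perm.mul_apply, Equiv.Perm.inv_eq_iff_eq, eq_comm]
  Equiv.ofBijective
    (Quotient.lift (fun g : G => β g x)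
      fun g h hgh => (key g h).1 (QuotientGroup.leftRel_apply.1 hgh))
    ⟨by
      rintro ⟨g⟩ ⟨h⟩ hgh
      exact QuotientGroup.eq.2 ((key g h).2 hgh),
     fun y => let ⟨g, hg⟩ := htrans y; ⟨(g : G ⧸ S), hg⟩⟩

/-- The right regular representation of `N`, transported to `X` along `b : X ≃ N`. -/
def rightRegularTransport {X N : Type*} [Group N] (b : X ≃ N) : N →* Equiv.Perm X where
  toFun η := (b.trans (Equiv.mulRight η⁻¹)).trans b.symm
  map_one' := by ext; simp
  map_mul' η μ := by ext; simp [mul_assoc]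

theorem rightRegularTransport_apply {X N : Type*} [Group N] (b : X ≃ N) (η : N) (x : X) :
    rightRegularTransport b η x = b.symm (b x * η⁻¹) :=
  rfl

theorem rightRegularTransport_apply_eq_iff {X N : Type*} [Group N] (b : X ≃ N) (η : N) (x y : X) :
    rightRegularTransport b η x = y ↔ η = (b y)⁻¹ * b x := by
  rw [rightRegularTransport_apply, Equiv.symm_apply_eq, mul_inv_eq_iff_eq_mul, eq_inv_mul_iff_mul_eq,
    eq_comm]

/-- Let `G` be a group, `S ≤ G`, `X = G/S`, and `N` a group.  Let
`β : G → Perm(N)` be an injective homomorphism with transitive image such that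
`β(g)(e_N) = e_N ↔ g ∈ S`.  Then `b : X → N`, `b(gS) = β(g)(e_N)`, is a
well-defined bijection with `b(S) = e_N`, and `α : N → Perm(X)`,
`α(η) = b⁻¹ ∘ ρ_N(η) ∘ b` (with `ρ_N(η)(μ) = μη⁻¹`), is an injective
homomorphism whose image acts regularly on `X`. -/
theorem transitive_embedding_to_regular {G N : Type*} [Group G] [Group N]
    (S : Subgroup G)
    (β : G →* Equiv.Perm N)
    (hβinj : Function.Injective β)
    (hβtrans : ∀ η μ : N, ∃ g : G, β g μ = η)
    (hβstab : ∀ g : G, β g 1 = 1 ↔ g ∈ S) :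
    ∃ b : G ⧸ S ≃ N,
      (∀ g : G, b ((g : G ⧸ S)) = β g 1) ∧
      b ((1 : G) : G ⧸ S) = 1 ∧
      ∃ α : N →* Equiv.Perm (G ⧸ S),
        (∀ η : N, ∀ x : G ⧸ S, α η x = b.symm (b x * η⁻¹)) ∧
        Function.Injective α ∧
        (∀ x y : G ⧸ S, ∃! η : N, α η x = y) := by
  let b := quotientEquivOfTransitive S β 1 (fun η => hβtrans η 1) hβstab
  have hb (g : G) : b (g : G ⧸ S) = β g 1 := rfl
  refine ⟨b, hb, by simp [hb], rightRegularTransport b, rightRegularTransport_apply b, ?_, ?_⟩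
  · intro η μ h
    have hη := (rightRegularTransport_apply_eq_iff b η (b.symm 1) _).1 rfl
    rw [h] at hη
    exact hη.trans ((rightRegularTransport_apply_eq_iff b μ (b.symm 1) _).1 rfl).symm
  · intro x y
    exact ⟨(b y)⁻¹ * b x, (rightRegularTransport_apply_eq_iff b _ x y).2 rfl,
      fun η hη => (rightRegularTransport_apply_eq_iff b η x y).1 hη⟩
end

section
/- Let G be a group and S a subgroup of G such that the left translation action λ_X : G → Perm(X) on X = G/S, λ_X(g)(g'S) = gg'S, is faithful (S has trivial normal core). Let N be a group and α : N → Perm(X) an injective group homomorphism whose image acts regularly on X. Define a : N → X by a(η) = α(η⁻¹)(S). Then a is a bijection with a(e_N) = S, and β : G → Perm(N) defined by β(g) = a⁻¹ ∘ λ_X(g) ∘ a is an injective group homomorphism such that β(G) acts transitively on N and, for g ∈ G, β(g)(e_N) = e_N if and only if g ∈ S. -/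
/-- Let `G` be a group and `S ≤ G` with trivial normal core (so left translation
on `X = G/S` is faithful).  Let `N` be a group and `α : N → Perm(X)` an
injective homomorphism with regular image.  Define `a : N → X` by
`a(η) = α(η⁻¹)(S)`.  Then `a` is a bijection with `a(e_N) = S`, and
`β : G → Perm(N)`, `β(g) = a⁻¹ ∘ λ_X(g) ∘ a`, is an injective homomorphism
with `β(G)` transitive on `N` and `β(g)(e_N) = e_N ↔ g ∈ S`. -/
theorem regular_embedding_to_transitive {G N : Type*} [Group G] [Group N]
    (S : Subgroup G)
    (hcore : ∀ g : G, (∀ x : G ⧸ S, g • x = x) → g = 1)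
    (α : N →* Equiv.Perm (G ⧸ S))
    (hαinj : Function.Injective α)
    (hαreg : ∀ x y : G ⧸ S, ∃! η : N, α η x = y) :
    ∃ a : N ≃ G ⧸ S,
      (∀ η : N, a η = α η⁻¹ (((1 : G) : G ⧸ S))) ∧
      a 1 = ((1 : G) : G ⧸ S) ∧
      ∃ β : G →* Equiv.Perm N,
        (∀ g : G, ∀ η : N, β g η = a.symm (g • a η)) ∧
        Function.Injective β ∧
        (∀ η μ : N, ∃ g : G, β g μ = η) ∧
        (∀ g : G, β g 1 = 1 ↔ g ∈ S) := by
  have hbij : Function.Bijective fun η : N => α η⁻¹ ((1 : G) : G ⧸ S) := by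
    refine ⟨fun η μ h => inv_injective ((hαreg _ _).unique h rfl), fun y => ?_⟩
    obtain ⟨η, hη, -⟩ := hαreg ((1 : G) : G ⧸ S) y
    exact ⟨η⁻¹, by simpa using hη⟩
  let a : N ≃ G ⧸ S := Equiv.ofBijective _ hbij
  have ha1 : a 1 = ((1 : G) : G ⧸ S) := by
    change α 1⁻¹ _ = _
    rw [inv_one, map_one, Equiv.Perm.one_apply]
  let β : G →* Equiv.Perm N :=
    a.symm.permCongrHom.toMonoidHom.comp (MulAction.toPermHom G (G ⧸ S))
  have hβ : ∀ g : G, ∀ η : N, β g η = a.symm (g • a η) := fun _ _ => rfl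
  refine ⟨a, fun _ => rfl, ha1, β, hβ, ?_, fun η μ => ?_, fun g => ?_⟩
  · refine (injective_iff_map_eq_one β).2 fun g hg => hcore g fun x => ?_
    have h := hβ g (a.symm x)
    rw [hg, Equiv.Perm.one_apply, a.apply_symm_apply] at h
    exact (a.symm.injective h).symm
  · obtain ⟨g, hg⟩ := MulAction.exists_smul_eq G (a μ) (a η)
    exact ⟨g, by rw [hβ, hg, a.symm_apply_apply]⟩
  · rw [hβ, a.symm_apply_eq, ha1, ← MulAction.mem_stabilizer_iff,
      MulAction.stabilizer_quotient]
end

section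
/- Let G be a group, S a subgroup of G with trivial normal core, X = G/S, N a group, and α : N → Perm(X) an injective homomorphism whose image acts regularly on X. Let a : N → X, a(η) = α(η⁻¹)(S), let β : G → Perm(N), β(g) = a⁻¹ ∘ λ_X(g) ∘ a, and let b : X → N, b(gS) = β(g)(e_N). Then b = a⁻¹, and for every η ∈ N one has b ∘ α(η) ∘ b⁻¹ = ρ_N(η), where ρ_N(η)(μ) = μη⁻¹; in particular the construction β ↦ α_b recovers α, so the two constructions are mutually inverse. -/
/-- With `S ≤ G` of trivial normal core, `X = G/S`, `α : N → Perm(X)` an injective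
homomorphism with regular image, `a : N → X`, `a(η) = α(η⁻¹)(S)`,
`β : G → Perm(N)`, `β(g) = a⁻¹ ∘ λ_X(g) ∘ a`, and `b : X → N`,
`b(gS) = β(g)(e_N)`: then `b = a⁻¹`, and for every `η ∈ N` one has
`b ∘ α(η) ∘ b⁻¹ = ρ_N(η)` where `ρ_N(η)(μ) = μη⁻¹`; in particular the
construction `β ↦ α_b` recovers `α`, so the two constructions are mutually
inverse. -/
theorem regular_transitive_mutually_inverse {G N : Type*} [Group G] [Group N]
    (S : Subgroup G)
    (hcore : ∀ g : G, (∀ x : G ⧸ S, g • x = x) → g = 1)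
    (α : N →* Equiv.Perm (G ⧸ S))
    (hαinj : Function.Injective α)
    (hαreg : ∀ x y : G ⧸ S, ∃! η : N, α η x = y)
    (a : N ≃ G ⧸ S)
    (ha : ∀ η : N, a η = α η⁻¹ (((1 : G) : G ⧸ S)))
    (b : G ⧸ S → N)
    (hb : ∀ g : G, b ((g : G ⧸ S)) = a.symm (g • a 1)) :
    (∀ x : G ⧸ S, b x = a.symm x) ∧
    (∀ η μ : N, b (α η (a μ)) = μ * η⁻¹) ∧
    (∀ η : N, ∀ x : G ⧸ S, α η x = a (b x * η⁻¹)) := by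
  have ha_one : a 1 = ((1 : G) : G ⧸ S) := by simp [ha]
  have hba : ∀ x : G ⧸ S, b x = a.symm x := by
    intro x
    induction x using QuotientGroup.induction_on with
    | H g => rw [hb, ha_one, MulAction.Quotient.smul_coe, smul_eq_mul, mul_one]
  have hαa : ∀ η μ : N, α η (a μ) = a (μ * η⁻¹) := by
    intro η μ
    rw [ha, ha, mul_inv_rev, inv_inv, map_mul, Equiv.Perm.mul_apply]
  refine ⟨hba, fun η μ => ?_, fun η x => ?_⟩
  · rw [hαa, hba, Equiv.symm_apply_apply]
  · rw [hba, ← hαa, Equiv.apply_symm_apply]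
end

section
/- Let G be a group, S a subgroup of G with trivial normal core, X = G/S, N a group, α : N → Perm(X) an injective homomorphism with regular image, a : N → X given by a(η) = α(η⁻¹)(S), and β : G → Perm(N) given by β(g) = a⁻¹ ∘ λ_X(g) ∘ a. Then for all g ∈ G and all η, μ ∈ N: λ_X(g) ∘ α(η) ∘ λ_X(g)⁻¹ = α(μ) if and only if β(g) ∘ ρ_N(η) ∘ β(g)⁻¹ = ρ_N(μ). Consequently, α(N) is normalised by λ_X(G) if and only if β(G) is contained in the normaliser of ρ_N(N) in Perm(N). -/
/-- With `S ≤ G` of trivial normal core, `X = G/S`, `α : N → Perm(X)` an injective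
homomorphism with regular image, `a(η) = α(η⁻¹)(S)` and
`β(g) = a⁻¹ ∘ λ_X(g) ∘ a`: for all `g ∈ G` and `η, μ ∈ N`,
`λ_X(g) ∘ α(η) ∘ λ_X(g)⁻¹ = α(μ)` iff `β(g) ∘ ρ_N(η) ∘ β(g)⁻¹ = ρ_N(μ)`.
Consequently `α(N)` is normalised by `λ_X(G)` iff `β(G)` lies in the
normaliser of `ρ_N(N)` in `Perm(N)`. -/
theorem G_stable_iff_normalises_rho {G N : Type*} [Group G] [Group N]
    (S : Subgroup G)
    (hcore : ∀ g : G, (∀ x : G ⧸ S, g • x = x) → g = 1)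
    (α : N →* Equiv.Perm (G ⧸ S))
    (hαinj : Function.Injective α)
    (hαreg : ∀ x y : G ⧸ S, ∃! η : N, α η x = y)
    (a : N ≃ G ⧸ S)
    (ha : ∀ η : N, a η = α η⁻¹ (((1 : G) : G ⧸ S))) :
    (∀ g : G, ∀ η μ : N,
      (∀ x : G ⧸ S, g • α η (g⁻¹ • x) = α μ x) ↔
      (∀ ν : N, a.symm (g • a (a.symm (g⁻¹ • a ν) * η⁻¹)) = ν * μ⁻¹)) ∧
    ((∀ g : G, ∀ η : N, ∃ μ : N, ∀ x : G ⧸ S, g • α η (g⁻¹ • x) = α μ x) ↔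
     (∀ g : G, ∀ η : N, ∃ μ : N, ∀ ν : N,
        a.symm (g • a (a.symm (g⁻¹ • a ν) * η⁻¹)) = ν * μ⁻¹)) := by
  have a_mul_inv : ∀ ν η : N, a (ν * η⁻¹) = α η (a ν) := fun ν η => by
    rw [ha, ha, mul_inv_rev, inv_inv, map_mul, Equiv.Perm.mul_apply]
  have key : ∀ g : G, ∀ η μ : N,
      (∀ x : G ⧸ S, g • α η (g⁻¹ • x) = α μ x) ↔
      (∀ ν : N, a.symm (g • a (a.symm (g⁻¹ • a ν) * η⁻¹)) = ν * μ⁻¹) := fun g η μ => by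
    simp only [Equiv.symm_apply_eq, a_mul_inv, Equiv.apply_symm_apply]
    exact a.surjective.forall
  exact ⟨key, forall₂_congr fun g η => exists_congr fun μ => key g η μ⟩
end

section
/- Let H and S be groups, φ : S → Aut(H) a group homomorphism, and G = H ⋊_φ S the external semidirect product, whose elements are pairs (h,s) with multiplication (h₁,s₁)(h₂,s₂) = (h₁·φ(s₁)(h₂), s₁s₂). Define r : G × G → G × G by r((h₁,s₁),(h₂,s₂)) = ((k, e_S), (k⁻¹h₁k, s₁s₂)), where k = φ(s₁)(h₂). Then r is a solution to the set-theoretic Yang–Baxter equation: (r × id)(id × r)(r × id) = (id × r)(r × id)(id × r) as maps on G × G × G. -/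
/-- Let `H`, `S` be groups, `φ : S → Aut(H)`, and `G = H ⋊_φ S`.  Define
`r((h₁,s₁),(h₂,s₂)) = ((k, e_S), (k⁻¹h₁k, s₁s₂))` with `k = φ(s₁)(h₂)`.  Then
`r` is a solution to the set-theoretic Yang–Baxter equation:
`(r × id)(id × r)(r × id) = (id × r)(r × id)(id × r)` on `G × G × G`. -/
theorem semidirect_product_yang_baxter {H S : Type*} [Group H] [Group S]
    (φ : S →* MulAut H)
    (r : (H ⋊[φ] S) × (H ⋊[φ] S) → (H ⋊[φ] S) × (H ⋊[φ] S))
    (hr : ∀ p : (H ⋊[φ] S) × (H ⋊[φ] S),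
      r p = (⟨φ p.1.right p.2.left, 1⟩,
             ⟨(φ p.1.right p.2.left)⁻¹ * p.1.left * φ p.1.right p.2.left,
              p.1.right * p.2.right⟩)) :
    (fun u : (H ⋊[φ] S) × (H ⋊[φ] S) × (H ⋊[φ] S) =>
        ((r (u.1, u.2.1)).1, (r (u.1, u.2.1)).2, u.2.2)) ∘
      (fun u : (H ⋊[φ] S) × (H ⋊[φ] S) × (H ⋊[φ] S) => (u.1, r (u.2.1, u.2.2))) ∘
      (fun u : (H ⋊[φ] S) × (H ⋊[φ] S) × (H ⋊[φ] S) =>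
        ((r (u.1, u.2.1)).1, (r (u.1, u.2.1)).2, u.2.2))
    = (fun u : (H ⋊[φ] S) × (H ⋊[φ] S) × (H ⋊[φ] S) => (u.1, r (u.2.1, u.2.2))) ∘
      (fun u : (H ⋊[φ] S) × (H ⋊[φ] S) × (H ⋊[φ] S) =>
        ((r (u.1, u.2.1)).1, (r (u.1, u.2.1)).2, u.2.2)) ∘
      (fun u : (H ⋊[φ] S) × (H ⋊[φ] S) × (H ⋊[φ] S) => (u.1, r (u.2.1, u.2.2))) := by
  funext ⟨⟨a, s⟩, ⟨b, t⟩, ⟨c, w⟩⟩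
  simp [hr, mul_assoc]
end
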